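/- arXiv:2105.12520 — 2 statements merged into one kernel-verified Lean document; each statement's English description precedes it below -/
import Mathlib

section
/- Let q be a prime power and n, k, m positive integers with k | m and m | n. Let γ ∈ F_{q^m}^* be a root of an irreducible polynomial of degree m/k over F_{q^k}, where m/k > 2, and let ξ ∈ F_{q^n}^* be a root of an irreducible polynomial of degree n/m over F_{q^m}, where n/m > 2. Let δ_1, δ_2 ∈ F_{q^k}^*. Then U = {a + δ_1 u γ + δ_2 u^q ξ : a ∈ F_q, u ∈ F_{q^k}} is a Sidon space of F_q-dimension k + 1. -/
open Submodule Pointwise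

set_option maxHeartbeats 1000000
set_option synthInstance.maxHeartbeats 400000

/-- An `F`-subspace `V` of a field `K` is a *Sidon space* if for all nonzero
`a, b, c, d ∈ V` with `a * b = c * d` one has `{aF, bF} = {cF, dF}` (as a pair of
one-dimensional `F`-subspaces). -/
def IsSidonSpace {K : Type*} [Field K] (F : Subfield K) (V : Submodule F K) : Prop :=
  ∀ a ∈ V, ∀ b ∈ V, ∀ c ∈ V, ∀ d ∈ V,
    a ≠ 0 → b ≠ 0 → c ≠ 0 → d ≠ 0 → a * b = c * d →
    ({Submodule.span F {a}, Submodule.span F {b}} : Set (Submodule F K)) =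
      {Submodule.span F {c}, Submodule.span F {d}}

/-- If `x` has degree at least `3` over `E`, then `1, x, x²` are linearly independent over `E`. -/
theorem eq_zero_of_quadratic_eq_zero {K : Type*} [Field K] (E : Subfield K) {x : K}
    (hx : 2 < (minpoly E x).natDegree) {a b c : K} (ha : a ∈ E) (hb : b ∈ E) (hc : c ∈ E)
    (h : a + b * x + c * x ^ 2 = 0) : a = 0 ∧ b = 0 ∧ c = 0 := by
  let p : Polynomial E :=
    Polynomial.C ⟨c, hc⟩ * Polynomial.X ^ 2 + Polynomial.C ⟨b, hb⟩ * Polynomial.X +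
      Polynomial.C ⟨a, ha⟩
  have hpx : Polynomial.aeval x p = 0 := by
    simp only [p, map_add, map_mul, Polynomial.aeval_C, Polynomial.aeval_X, map_pow]
    change c * x ^ 2 + b * x + a = 0
    linear_combination h
  have hp : p = 0 := by
    by_contra hp
    have hdeg := Polynomial.natDegree_le_natDegree (minpoly.degree_le_of_ne_zero E x hp hpx)
    have : p.natDegree ≤ 2 := Polynomial.natDegree_quadratic_le
    omega
  have h0 := congrArg (fun r => ((r.coeff 0 : E) : K)) hp
  have h1 := congrArg (fun r => ((r.coeff 1 : E) : K)) hp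
  have h2 := congrArg (fun r => ((r.coeff 2 : E) : K)) hp
  simp [p, Polynomial.coeff_X, Polynomial.coeff_C] at h0 h1 h2
  exact ⟨h0, h1, h2⟩

/-- In a tower `Fk ≤ Fm`, the elements `1, γ, γ², ξ, ξ²` are independent, with coefficients of
powers of `γ` in `Fk` and coefficients of powers of `ξ` in `Fm`. -/
theorem eq_zero_of_quadratic_tower {K : Type*} [Field K] {Fk Fm : Subfield K} (hle : Fk ≤ Fm)
    {γ ξ : K} (hγ : γ ∈ Fm) (hdegγ : 2 < (minpoly Fk γ).natDegree)
    (hdegξ : 2 < (minpoly Fm ξ).natDegree) {a b c r s : K} (ha : a ∈ Fk) (hb : b ∈ Fk)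
    (hc : c ∈ Fk) (hr : r ∈ Fm) (hs : s ∈ Fm)
    (h : a + b * γ + c * γ ^ 2 + r * ξ + s * ξ ^ 2 = 0) :
    a = 0 ∧ b = 0 ∧ c = 0 ∧ r = 0 := by
  have h₁ := eq_zero_of_quadratic_eq_zero Fm hdegξ
    (add_mem (add_mem (hle ha) (mul_mem (hle hb) hγ)) (mul_mem (hle hc) (pow_mem hγ 2))) hr hs h
  have h₂ := eq_zero_of_quadratic_eq_zero Fk hdegγ ha hb hc h₁.1
  exact ⟨h₂.1, h₂.2.1, h₂.2.2, h₁.2.1⟩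

/-- Two nonzero proportional vectors of `K²` are multiples of each other. -/
theorem exists_scalar_of_cross_eq {K : Type*} [Field K] {a u c w : K} (h₁ : ¬(a = 0 ∧ u = 0))
    (h₂ : ¬(c = 0 ∧ w = 0)) (h : a * w = u * c) : ∃ l ≠ 0, a = l * c ∧ u = l * w := by
  by_cases hc : c = 0
  · have hw : w ≠ 0 := fun hw => h₂ ⟨hc, hw⟩
    have ha : a = 0 := by simpa [hc, hw] using h
    have hu : u ≠ 0 := fun hu => h₁ ⟨ha, hu⟩
    exact ⟨u / w, div_ne_zero hu hw, by simp [ha, hc], by field_simp⟩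
  · have ha : a ≠ 0 := by
      intro ha
      have hu : u = 0 := by simpa [ha, hc, eq_comm] using h
      exact h₁ ⟨ha, hu⟩
    exact ⟨a / c, div_ne_zero ha hc, by field_simp, by field_simp; linear_combination -h⟩

/-- If `(a + ux)(b + vx) = (c + wx)(d + zx)` and `a + ux` is a scalar multiple `l` of `c + wx`,
then `d + zx` is the multiple `l` of `b + vx`. -/
theorem cofactor_eq_of_scalar {K : Type*} [Field K] {a b c d u v w z l : K}
    (hcw : ¬(c = 0 ∧ w = 0)) (h₀ : a * b = c * d) (h₁ : a * v + b * u = c * z + d * w)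
    (h₂ : u * v = w * z) (ha : a = l * c) (hu : u = l * w) : d = l * b ∧ z = l * v := by
  subst ha hu
  by_cases hc : c = 0
  · have hw : w ≠ 0 := fun hw => hcw ⟨hc, hw⟩
    subst hc
    exact ⟨mul_left_cancel₀ hw (by linear_combination -h₁),
      mul_left_cancel₀ hw (by linear_combination -h₂)⟩
  · have hd : d = l * b := mul_left_cancel₀ hc (by linear_combination -h₀)
    refine ⟨hd, mul_left_cancel₀ hc ?_⟩
    subst hd
    linear_combination -h₁

/-- Unique factorization of a product of two nonzero linear forms. -/
theorem linear_forms_unique_factorization {K : Type*} [Field K] {a b c d u v w z : K}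
    (hau : ¬(a = 0 ∧ u = 0)) (hcw : ¬(c = 0 ∧ w = 0)) (hdz : ¬(d = 0 ∧ z = 0))
    (h₀ : a * b = c * d) (h₁ : a * v + b * u = c * z + d * w) (h₂ : u * v = w * z) :
    (∃ l ≠ 0, a = l * c ∧ u = l * w ∧ d = l * b ∧ z = l * v) ∨
      ∃ l ≠ 0, a = l * d ∧ u = l * z ∧ c = l * b ∧ w = l * v := by
  have hprod : (a * w - u * c) * (a * z - u * d) = 0 := by
    linear_combination -u ^ 2 * h₀ - a ^ 2 * h₂ + a * u * h₁
  rcases mul_eq_zero.1 hprod with h | h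
  · obtain ⟨l, hl, ha, hu⟩ := exists_scalar_of_cross_eq hau hcw (sub_eq_zero.1 h)
    exact .inl ⟨l, hl, ha, hu, cofactor_eq_of_scalar hcw h₀ h₁ h₂ ha hu⟩
  · obtain ⟨l, hl, ha, hu⟩ := exists_scalar_of_cross_eq hau hdz (sub_eq_zero.1 h)
    exact .inr ⟨l, hl, ha, hu, cofactor_eq_of_scalar hdz (by linear_combination h₀)
      (by linear_combination h₁) (by linear_combination h₂) ha hu⟩

/-- In a finite field, the fixed points of `x ↦ x ^ |F|` lie in `F`. -/
theorem Subfield.mem_of_pow_natCard_eq_self {K : Type*} [Field K] [Finite K] (F : Subfield K)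
    {x : K} (hx : x ^ Nat.card F = x) : x ∈ F := by
  have hq : 1 < Nat.card F := Finite.one_lt_card
  set p : Polynomial K := Polynomial.X ^ Nat.card F - Polynomial.X
  have hp : p ≠ 0 := FiniteField.X_pow_card_sub_X_ne_zero K hq
  have hdeg : p.natDegree = Nat.card F := FiniteField.X_pow_card_sub_X_natDegree_eq K hq
  have hsub : (F : Set K) ⊆ p.rootSet K := by
    intro y hy
    rw [Polynomial.mem_rootSet_of_ne hp]
    have hy' : (⟨y, hy⟩ : F) ^ Nat.card F = ⟨y, hy⟩ := by
      have := Fintype.ofFinite F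
      rw [Nat.card_eq_fintype_card, FiniteField.pow_card]
    simpa [p, sub_eq_zero] using congrArg Subtype.val hy'
  have heq := Set.eq_of_subset_of_ncard_le hsub (hdeg ▸ Polynomial.ncard_rootSet_le p K :
    (p.rootSet K).ncard ≤ Nat.card F)
    (Set.toFinite _)
  change x ∈ (F : Set K)
  rw [heq, Polynomial.mem_rootSet_of_ne hp]
  simp [p, hx]

/-- Scaling by a nonzero element of `F` does not change the spanned line. -/
theorem span_singleton_eq_of_eq_mul {K : Type*} [Field K] {F : Subfield K} {l x y : K}
    (hlF : l ∈ F) (hl : l ≠ 0) (h : x = l * y) : span F {x} = span F {y} := by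
  have hunit : IsUnit (⟨l, hlF⟩ : F) := Ne.isUnit fun h0 => hl (congrArg Subtype.val h0)
  rw [h]
  exact span_singleton_smul_eq hunit y

/-- The `F`-linear map `(a, u) ↦ a + α u + β u^q`, where `q = |F|`. -/
noncomputable def twoGeneratorMap {K : Type*} [Field K] (F : Subfield K) [Fintype F]
    (S : Submodule F K) (α β : K) : F × S →ₗ[F] K :=
  (Algebra.linearMap F K).coprod
    ((LinearMap.mulLeft F α + LinearMap.mulLeft F β ∘ₗ
      (FiniteField.frobeniusAlgHom F K).toLinearMap) ∘ₗ S.subtype)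

theorem twoGeneratorMap_apply {K : Type*} [Field K] (F : Subfield K) [Fintype F]
    (S : Submodule F K) (α β : K) (p : F × S) :
    twoGeneratorMap F S α β p = p.1 + (α * p.2 + β * (p.2 : K) ^ Nat.card F) := by
  rw [Nat.card_eq_fintype_card]
  rfl

/-- The comparison of the two factorizations: if the linear forms agree up to a scalar `l`, and
the `q`-twisted products agree, the corresponding lines agree. -/
theorem pair_span_eq_of_scalar {K : Type*} [Field K] [Finite K] (F : Subfield K) {α β l : K}
    (hl : l ≠ 0) {a b c d u v w z : K} (ha : a ∈ F) (hb : b ∈ F) (hc : c ∈ F) (hd : d ∈ F)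
    (hbv : ¬(b = 0 ∧ v = 0)) (hcw : ¬(c = 0 ∧ w = 0))
    (hac : a = l * c) (huw : u = l * w) (hdb : d = l * b) (hzv : z = l * v)
    (htwist : u ^ Nat.card F * v + v ^ Nat.card F * u =
      w ^ Nat.card F * z + z ^ Nat.card F * w) :
    ({span F {a + (α * u + β * u ^ Nat.card F)}, span F {b + (α * v + β * v ^ Nat.card F)}} :
        Set (Submodule F K)) =
      {span F {c + (α * w + β * w ^ Nat.card F)}, span F {d + (α * z + β * z ^ Nat.card F)}} := by
  have hfix : ∀ x ∈ F, x ^ Nat.card F = x := fun x hx => by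
    have := Fintype.ofFinite F
    rw [Nat.card_eq_fintype_card]
    exact congrArg Subtype.val (FiniteField.pow_card (⟨x, hx⟩ : F))
  by_cases hlF : l ∈ F
  · have h₁ : span F {a + (α * u + β * u ^ Nat.card F)} =
        span F {c + (α * w + β * w ^ Nat.card F)} := by
      refine span_singleton_eq_of_eq_mul hlF hl ?_
      rw [hac, huw, mul_pow, hfix l hlF]
      ring
    have h₂ : span F {d + (α * z + β * z ^ Nat.card F)} =
        span F {b + (α * v + β * v ^ Nat.card F)} := by
      refine span_singleton_eq_of_eq_mul hlF hl ?_
      rw [hdb, hzv, mul_pow, hfix l hlF]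
      ring
    rw [h₁, h₂]
  · have hc0 : c = 0 := by
      by_contra hc0
      exact hlF (by rw [show l = a / c by rw [hac]; field_simp]; exact div_mem ha hc)
    have hb0 : b = 0 := by
      by_contra hb0
      exact hlF (by rw [show l = d / b by rw [hdb]; field_simp]; exact div_mem hd hb)
    have hw : w ≠ 0 := fun h => hcw ⟨hc0, h⟩
    have hv : v ≠ 0 := fun h => hbv ⟨hb0, h⟩
    have hprod : (l ^ Nat.card F - l) * (w ^ Nat.card F * v - v ^ Nat.card F * w) = 0 := by
      rw [huw, hzv, mul_pow, mul_pow] at htwist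
      linear_combination htwist
    have hvw : w ^ Nat.card F * v = v ^ Nat.card F * w :=
      (mul_eq_zero.1 hprod).elim
        (fun h => (hlF (F.mem_of_pow_natCard_eq_self (sub_eq_zero.1 h))).elim) sub_eq_zero.1
    have hμ : w / v ∈ F := F.mem_of_pow_natCard_eq_self (by
      rw [div_pow, div_eq_div_iff (pow_ne_zero _ hv) hv, hvw, mul_comm])
    have hμ0 : w / v ≠ 0 := div_ne_zero hw hv
    have hwv : w = w / v * v := by field_simp
    have huz : u = w / v * z := by rw [huw, hzv]; field_simp
    have hline : ∀ {x y : K}, x = w / v * y →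
        span F {0 + (α * x + β * x ^ Nat.card F)} =
          span F {0 + (α * y + β * y ^ Nat.card F)} := by
      intro x y hxy
      refine span_singleton_eq_of_eq_mul hμ hμ0 ?_
      rw [hxy, mul_pow, hfix _ hμ]
      ring
    have ha0 : a = 0 := by rw [hac, hc0, mul_zero]
    have hd0 : d = 0 := by rw [hdb, hb0, mul_zero]
    rw [ha0, hb0, hc0, hd0, hline huz, hline hwv, Set.pair_comm]

/-- For `k ∣ m ∣ n`, `γ ∈ F_{q^m}^*` a root of an irreducible polynomial of
degree `m/k > 2` over `F_{q^k}`, `ξ ∈ F_{q^n}^*` a root of an irreducible polynomial of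
degree `n/m > 2` over `F_{q^m}`, and `δ₁, δ₂ ∈ F_{q^k}^*`, the set
`U = {a + δ₁uγ + δ₂uᑫξ : a ∈ F_q, u ∈ F_{q^k}}` is a Sidon space of dimension `k + 1`. -/
theorem sidonSpace_two_generators {K : Type*} [Field K] (q n k m : ℕ)
    (hq : IsPrimePow q) (hn : 0 < n) (hk : 0 < k) (hm : 0 < m)
    (hkm : k ∣ m) (hmn : m ∣ n)
    (hK : Nat.card K = q ^ n)
    (F : Subfield K) (hF : Nat.card F = q)
    (Fk : Subfield K) (hFk : Nat.card Fk = q ^ k) (hFFk : F ≤ Fk)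
    (Fm : Subfield K) (hFm : Nat.card Fm = q ^ m) (hFkFm : Fk ≤ Fm)
    (γ : K) (hγFm : γ ∈ Fm) (hγ : γ ≠ 0)
    (hdegγ : (minpoly Fk γ).natDegree = m / k) (hdegγ2 : 2 < m / k)
    (ξ : K) (hξ : ξ ≠ 0)
    (hdegξ : (minpoly Fm ξ).natDegree = n / m) (hdegξ2 : 2 < n / m)
    (δ₁ δ₂ : K) (hδ₁ : δ₁ ∈ Fk) (hδ₂ : δ₂ ∈ Fk) (hδ₁0 : δ₁ ≠ 0) (hδ₂0 : δ₂ ≠ 0) :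
    IsSidonSpace F
        (Submodule.span F
          {x : K | ∃ a ∈ F, ∃ u ∈ Fk, x = a + δ₁ * u * γ + δ₂ * u ^ q * ξ}) ∧
      Module.finrank F
        ↥(Submodule.span F
          {x : K | ∃ a ∈ F, ∃ u ∈ Fk, x = a + δ₁ * u * γ + δ₂ * u ^ q * ξ}) = k + 1 := by
  have hq1 : 1 < q := hq.one_lt
  have : Finite K := Nat.finite_of_card_ne_zero (by rw [hK]; positivity)
  have := Fintype.ofFinite F
  have hdegγ' : 2 < (minpoly Fk γ).natDegree := hdegγ ▸ hdegγ2
  have hdegξ' : 2 < (minpoly Fm ξ).natDegree := hdegξ ▸ hdegξ2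
  let S : Submodule F K :=
    { carrier := Fk
      add_mem' := Fk.add_mem
      zero_mem' := Fk.zero_mem
      smul_mem' := fun r x hx => Fk.mul_mem (hFFk r.2) hx }
  let φ := twoGeneratorMap F S (δ₁ * γ) (δ₂ * ξ)
  have hφ : ∀ p : F × S, φ p = p.1 + (δ₁ * γ * p.2 + δ₂ * ξ * (p.2 : K) ^ Nat.card F) :=
    twoGeneratorMap_apply F S _ _
  have hspan : span F {x : K | ∃ a ∈ F, ∃ u ∈ Fk, x = a + δ₁ * u * γ + δ₂ * u ^ q * ξ} =
      LinearMap.range φ := by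
    rw [← span_eq (LinearMap.range φ)]
    congr 1
    ext x
    constructor
    · rintro ⟨a, ha, u, hu, rfl⟩
      refine ⟨(⟨a, ha⟩, ⟨u, hu⟩), ?_⟩
      rw [hφ, hF]
      ring
    · rintro ⟨⟨a, u⟩, rfl⟩
      refine ⟨a, a.2, u, u.2, ?_⟩
      rw [hφ, hF]
      ring
  have hinj : Function.Injective φ := by
    rw [injective_iff_map_eq_zero]
    rintro ⟨⟨a, ha⟩, ⟨u, hu⟩⟩ h
    rw [hφ] at h
    have hu' : u ∈ Fk := hu
    obtain ⟨ha0, hu0, -, -⟩ := eq_zero_of_quadratic_tower hFkFm hγFm hdegγ' hdegξ'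
      (hFFk ha) (mul_mem hδ₁ hu') Fk.zero_mem
      (mul_mem (hFkFm hδ₂) (pow_mem (hFkFm hu') (Nat.card F))) Fm.zero_mem
      (by linear_combination h)
    have hu0 : u = 0 := (mul_eq_zero.1 hu0).resolve_left hδ₁0
    subst ha0 hu0
    rfl
  rw [hspan]
  constructor
  · rintro _ ⟨⟨⟨a, ha⟩, ⟨u, hu⟩⟩, rfl⟩ _ ⟨⟨⟨b, hb⟩, ⟨v, hv⟩⟩, rfl⟩ _ ⟨⟨⟨c, hc⟩, ⟨w, hw⟩⟩, rfl⟩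
      _ ⟨⟨⟨d, hd⟩, ⟨z, hz⟩⟩, rfl⟩ hau hbv hcw hdz h
    have hne : ∀ {a u : K} (ha : a ∈ F) (hu : u ∈ S), φ (⟨a, ha⟩, ⟨u, hu⟩) ≠ 0 →
        ¬(a = 0 ∧ u = 0) := by
      rintro a u ha hu h ⟨rfl, rfl⟩
      exact h (map_zero φ)
    have hau' := hne ha hu hau
    have hbv' := hne hb hv hbv
    have hcw' := hne hc hw hcw
    have hdz' := hne hd hz hdz
    simp only [hφ] at h ⊢
    change u ∈ Fk at hu
    change v ∈ Fk at hv
    change w ∈ Fk at hw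
    change z ∈ Fk at hz
    have hpow : ∀ {x : K}, x ∈ Fk → x ^ Nat.card F ∈ Fk := fun hx => pow_mem hx _
    have ha' := hFFk ha
    have hb' := hFFk hb
    have hc' := hFFk hc
    have hd' := hFFk hd
    have h₁mem : b * u ^ Nat.card F + a * v ^ Nat.card F - d * w ^ Nat.card F -
        c * z ^ Nat.card F ∈ Fk :=
      sub_mem (sub_mem (add_mem (mul_mem hb' (hpow hu)) (mul_mem ha' (hpow hv)))
        (mul_mem hd' (hpow hw))) (mul_mem hc' (hpow hz))
    have h₂mem : δ₁ * (u ^ Nat.card F * v + v ^ Nat.card F * u - w ^ Nat.card F * z -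
        z ^ Nat.card F * w) ∈ Fk :=
      mul_mem hδ₁ (sub_mem (sub_mem (add_mem (mul_mem (hpow hu) hv) (mul_mem (hpow hv) hu))
        (mul_mem (hpow hw) hz)) (mul_mem (hpow hz) hw))
    obtain ⟨e₀, e₁, e₂, e₃⟩ := eq_zero_of_quadratic_tower hFkFm hγFm hdegγ' hdegξ'
      (sub_mem (mul_mem ha' hb') (mul_mem hc' hd'))
      (mul_mem hδ₁ (sub_mem (add_mem (mul_mem ha' hv) (mul_mem hb' hu))
        (add_mem (mul_mem hc' hz) (mul_mem hd' hw))))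
      (mul_mem (pow_mem hδ₁ 2) (sub_mem (mul_mem hu hv) (mul_mem hw hz)))
      (mul_mem (hFkFm hδ₂) (add_mem (hFkFm h₁mem) (mul_mem (hFkFm h₂mem) hγFm)))
      (mul_mem (hFkFm (pow_mem hδ₂ 2)) (hFkFm (sub_mem (mul_mem (hpow hu) (hpow hv))
        (mul_mem (hpow hw) (hpow hz)))))
      (by linear_combination h)
    have f₀ := sub_eq_zero.1 e₀
    have f₁ := sub_eq_zero.1 ((mul_eq_zero.1 e₁).resolve_left hδ₁0)
    have f₂ := sub_eq_zero.1 ((mul_eq_zero.1 e₂).resolve_left (pow_ne_zero 2 hδ₁0))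
    obtain ⟨-, e₄, -⟩ := eq_zero_of_quadratic_eq_zero Fk hdegγ' h₁mem h₂mem Fk.zero_mem
      (by linear_combination (mul_eq_zero.1 e₃).resolve_left hδ₂0)
    have f₃ := (mul_eq_zero.1 e₄).resolve_left hδ₁0
    rcases linear_forms_unique_factorization hau' hcw' hdz' f₀ f₁ f₂ with
      ⟨l, hl, h₁, h₂, h₃, h₄⟩ | ⟨l, hl, h₁, h₂, h₃, h₄⟩
    · exact pair_span_eq_of_scalar F hl ha hb hc hd hbv' hcw' h₁ h₂ h₃ h₄
        (by linear_combination f₃)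
    · rw [Set.pair_comm (span F {c + _})]
      exact pair_span_eq_of_scalar F hl ha hb hd hc hbv' hdz' h₁ h₂ h₃ h₄
        (by linear_combination f₃)
  · have hS : Module.finrank F S = k := by
      have hcard : Nat.card S = Nat.card F ^ Module.finrank F S := Module.natCard_eq_pow_finrank
      rw [hF, show Nat.card S = q ^ k from hFk] at hcard
      exact (Nat.pow_right_injective hq1 hcard).symm
    rw [LinearMap.finrank_range_of_inj hinj, Module.finrank_prod, Module.finrank_self, hS,
      add_comm]
end

section
/- Let q be a prime power and n, k, m positive integers with k | m and m | n. Let γ ∈ F_{q^m}^* be a root of an irreducible polynomial of degree m/k over F_{q^k}, where m/k > 2, and let ξ ∈ F_{q^n}^* be a root of an irreducible polynomial of degree n/m over F_{q^m}, where n/m > 4. Let δ_1, δ_2, τ_1, τ_2 ∈ F_{q^k}^*. Then U = {δ_1 a + δ_2 a^q γ + τ_1 u ξ + τ_2 u^q ξ^2 : a, u ∈ F_{q^k}} is a Sidon space of F_q-dimension 2k. -/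
open Submodule Pointwise

set_option maxHeartbeats 1000000
set_option synthInstance.maxHeartbeats 400000

/-- Powers of `x` below the degree of its minimal polynomial over a subfield `S` are linearly
independent over `S`. -/
theorem Subfield.coeff_eq_zero_of_sum_pow_eq_zero {K : Type*} [Field K] (S : Subfield K) {x : K}
    {N : ℕ} (hN : N ≤ (minpoly S x).natDegree) (c : Fin N → K) (hc : ∀ i, c i ∈ S)
    (h : ∑ i, c i * x ^ (i : ℕ) = 0) (i : Fin N) : c i = 0 := by
  have hli := (linearIndependent_pow (K := S) x).comp _ (Fin.castLE_injective hN)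
  have := Fintype.linearIndependent_iff.mp hli (fun i => ⟨c i, hc i⟩)
    (by simpa [Subfield.smul_def] using h) i
  simpa using congrArg Subtype.val this

theorem Subfield.mem_of_pow_natCard_eq {K : Type*} [Field K] (F : Subfield K) [Finite F] {x : K}
    (hx : x ^ Nat.card F = x) : x ∈ F := by
  classical
  have := Fintype.ofFinite F
  by_contra hxF
  have h1 : 1 < Nat.card F := Finite.one_lt_card
  let Z : Finset K := insert x (Finset.univ.image ((↑) : F → K))
  have hZ : Z.card = Nat.card F + 1 := by
    rw [Finset.card_insert_of_notMem (by simpa using hxF),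
      Finset.card_image_of_injective _ Subtype.val_injective, Finset.card_univ,
      Nat.card_eq_fintype_card]
  have hle := Polynomial.card_le_degree_of_subset_roots
    (p := (Polynomial.X ^ Nat.card F - Polynomial.X : Polynomial K)) (Z := Z) fun y hy => by
      rw [Polynomial.mem_roots (FiniteField.X_pow_card_sub_X_ne_zero K h1)]
      simp only [Polynomial.IsRoot.def, Polynomial.eval_sub, Polynomial.eval_pow,
        Polynomial.eval_X, sub_eq_zero]
      rcases Finset.mem_insert.mp hy with rfl | hy
      · exact hx
      · obtain ⟨z, -, rfl⟩ := Finset.mem_image.mp hy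
        rw [Nat.card_eq_fintype_card]
        exact_mod_cast FiniteField.pow_card z
  rw [hZ, FiniteField.X_pow_card_sub_X_natDegree_eq K h1] at hle
  omega

/-- If two products of linear forms agree, every linear form on one side is proportional to one
on the other side. -/
theorem exists_eq_smul_of_symm_mul_eq {ι K : Type*} [Field K] {x y z w : ι → K} (hx : x ≠ 0)
    (hz : z ≠ 0) (hw : w ≠ 0) (hdiag : ∀ i, x i * y i = z i * w i)
    (hsymm : ∀ i j, x i * y j + x j * y i = z i * w j + z j * w i) :
    ∃ c : K, x = c • z ∨ x = c • w := by
  obtain ⟨i, hi⟩ := Function.ne_iff.mp hx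
  have hi : x i ≠ 0 := hi
  have key : ∀ j l, (z i * x j - z j * x i) * (w i * x l - w l * x i) +
      (z i * x l - z l * x i) * (w i * x j - w j * x i) = 0 := fun j l => by
    linear_combination -2 * x j * x l * hdiag i + x i * x j * hsymm i l + x i * x l * hsymm i j
      - x i ^ 2 * hsymm j l
  have key' : ∀ j, (z i * x j - z j * x i) * (w i * x j - w j * x i) = 0 := fun j => by
    linear_combination -x j ^ 2 * hdiag i + x i * x j * hsymm i j - x i ^ 2 * hdiag j
  have prop : ∀ v : ι → K, v ≠ 0 → (∀ j, v i * x j - v j * x i = 0) → ∃ c : K, x = c • v := by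
    intro v hv h
    have hvi : v i ≠ 0 := by
      intro h0
      refine hv (funext fun j => ?_)
      have := h j
      simpa [h0, hi] using this
    refine ⟨x i / v i, funext fun j => ?_⟩
    simp only [Pi.smul_apply, smul_eq_mul]
    field_simp
    linear_combination h j
  by_cases h : ∀ j, z i * x j - z j * x i = 0
  · obtain ⟨c, hc⟩ := prop z hz h
    exact ⟨c, .inl hc⟩
  · push Not at h
    obtain ⟨j, hj⟩ := h
    have hwj := (mul_eq_zero.mp (key' j)).resolve_left hj
    obtain ⟨c, hc⟩ := prop w hw fun l => by
      have := key j l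
      rw [hwj, mul_zero, add_zero] at this
      exact (mul_eq_zero.mp this).resolve_left hj
    exact ⟨c, .inr hc⟩

theorem isSidonSpace_of_mem_span_singleton {K : Type*} [Field K] {F : Subfield K}
    {V : Submodule F K}
    (h : ∀ a ∈ V, ∀ b ∈ V, ∀ c ∈ V, ∀ d ∈ V,
      a ≠ 0 → b ≠ 0 → c ≠ 0 → d ≠ 0 → a * b = c * d → ∃ r ∈ F, a = r * c ∨ a = r * d) :
    IsSidonSpace F V := by
  have aux : ∀ {a b c d r : K}, a ≠ 0 → b ≠ 0 → c ≠ 0 → r ∈ F → a * b = c * d → a = r * c →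
      span F {a} = span F {c} ∧ span F {b} = span F {d} := by
    intro a b c d r ha hb hc hr hab hac
    have hr0 : r ≠ 0 := by rintro rfl; simp [hac] at ha
    have hu : IsUnit (⟨r, hr⟩ : F) := (Ne.isUnit (by simpa [Subtype.ext_iff] using hr0))
    have hdb : d = r * b := mul_left_cancel₀ hc (by rw [← hab, hac]; ring)
    have h1 := span_singleton_smul_eq hu c
    have h2 := span_singleton_smul_eq hu b
    rw [Subfield.smul_def, smul_eq_mul] at h1 h2
    exact ⟨by rw [hac]; exact h1, by rw [hdb]; exact h2.symm⟩
  intro a ha b hb c hc d hd ha0 hb0 hc0 hd0 hab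
  obtain ⟨r, hr, hac | had⟩ := h a ha b hb c hc d hd ha0 hb0 hc0 hd0 hab
  · obtain ⟨h1, h2⟩ := aux ha0 hb0 hc0 hr hab hac
    rw [h1, h2]
  · obtain ⟨h1, h2⟩ := aux ha0 hb0 hd0 hr (hab.trans (mul_comm c d)) had
    rw [h1, h2, Set.pair_comm]

section TwoGenerators

variable {K : Type*} [Field K]

/-- The element of `K` with coordinates `x` with respect to `1, γ, ξ, ξ ^ 2`. -/
def twoGenForm (γ ξ : K) (x : Fin 4 → K) : K :=
  x 0 + x 1 * γ + x 2 * ξ + x 3 * ξ ^ 2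

variable {Fk Fm : Subfield K} {γ ξ : K}

theorem eq_zero_of_quadratic_eq_zero_s9 (hγ : 2 < (minpoly Fk γ).natDegree) {c₀ c₁ c₂ : K}
    (h₀ : c₀ ∈ Fk) (h₁ : c₁ ∈ Fk) (h₂ : c₂ ∈ Fk) (h : c₀ + c₁ * γ + c₂ * γ ^ 2 = 0) :
    c₀ = 0 ∧ c₁ = 0 ∧ c₂ = 0 := by
  have := Fk.coeff_eq_zero_of_sum_pow_eq_zero (N := 3) hγ ![c₀, c₁, c₂]
    (by simp [Fin.forall_fin_succ, h₀, h₁, h₂]) (by simpa [Fin.sum_univ_succ, add_assoc] using h)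
  simpa [Fin.forall_fin_succ] using this

theorem eq_zero_of_quartic_eq_zero (hξ : 4 < (minpoly Fm ξ).natDegree) {c₀ c₁ c₂ c₃ c₄ : K}
    (h₀ : c₀ ∈ Fm) (h₁ : c₁ ∈ Fm) (h₂ : c₂ ∈ Fm) (h₃ : c₃ ∈ Fm) (h₄ : c₄ ∈ Fm)
    (h : c₀ + c₁ * ξ + c₂ * ξ ^ 2 + c₃ * ξ ^ 3 + c₄ * ξ ^ 4 = 0) :
    c₀ = 0 ∧ c₁ = 0 ∧ c₂ = 0 ∧ c₃ = 0 ∧ c₄ = 0 := by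
  have := Fm.coeff_eq_zero_of_sum_pow_eq_zero (N := 5) hξ ![c₀, c₁, c₂, c₃, c₄]
    (by simp [Fin.forall_fin_succ, h₀, h₁, h₂, h₃, h₄])
    (by simpa [Fin.sum_univ_succ, add_assoc] using h)
  simpa [Fin.forall_fin_succ] using this

theorem twoGenForm_eq_zero (hγ : 2 < (minpoly Fk γ).natDegree) (hξ : 4 < (minpoly Fm ξ).natDegree)
    (hle : Fk ≤ Fm) (hγm : γ ∈ Fm) {x : Fin 4 → K} (hx : ∀ i, x i ∈ Fk)
    (h : twoGenForm γ ξ x = 0) : x = 0 := by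
  have hxm i : x i ∈ Fm := hle (hx i)
  obtain ⟨h0, h2, h3, -⟩ := eq_zero_of_quartic_eq_zero hξ
    (add_mem (hxm 0) (mul_mem (hxm 1) hγm)) (hxm 2) (hxm 3) Fm.zero_mem Fm.zero_mem
    (by simpa [twoGenForm] using h)
  obtain ⟨h0, h1, -⟩ := eq_zero_of_quadratic_eq_zero_s9 hγ (hx 0) (hx 1) Fk.zero_mem
    (by simpa using h0)
  funext i
  fin_cases i <;> assumption

theorem symm_mul_eq_of_twoGenForm_mul_eq (hγ : 2 < (minpoly Fk γ).natDegree)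
    (hξ : 4 < (minpoly Fm ξ).natDegree) (hle : Fk ≤ Fm) (hγm : γ ∈ Fm) {x y z w : Fin 4 → K}
    (hx : ∀ i, x i ∈ Fk) (hy : ∀ i, y i ∈ Fk) (hz : ∀ i, z i ∈ Fk) (hw : ∀ i, w i ∈ Fk)
    (h : twoGenForm γ ξ x * twoGenForm γ ξ y = twoGenForm γ ξ z * twoGenForm γ ξ w)
    (h23 : x 3 * y 3 = z 3 * w 3 → x 2 * y 2 = z 2 * w 2) :
    (∀ i, x i * y i = z i * w i) ∧
      ∀ i j, x i * y j + x j * y i = z i * w j + z j * w i := by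
  let s : Fin 4 → Fin 4 → K := fun i j => x i * y j + x j * y i - (z i * w j + z j * w i)
  let t : Fin 4 → K := fun i => x i * y i - z i * w i
  have hs i j : s i j ∈ Fk := sub_mem
    (add_mem (mul_mem (hx i) (hy j)) (mul_mem (hx j) (hy i)))
    (add_mem (mul_mem (hz i) (hw j)) (mul_mem (hz j) (hw i)))
  have ht i : t i ∈ Fk := sub_mem (mul_mem (hx i) (hy i)) (mul_mem (hz i) (hw i))
  have hγ2 : γ ^ 2 ∈ Fm := pow_mem hγm 2
  obtain ⟨e0, e1, e2, e3, e4⟩ := eq_zero_of_quartic_eq_zero hξ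
    (c₀ := t 0 + s 0 1 * γ + t 1 * γ ^ 2) (c₁ := s 0 2 + s 1 2 * γ)
    (c₂ := s 0 3 + t 2 + s 1 3 * γ) (c₃ := s 2 3) (c₄ := t 3)
    (add_mem (add_mem (hle (ht 0)) (mul_mem (hle (hs 0 1)) hγm)) (mul_mem (hle (ht 1)) hγ2))
    (add_mem (hle (hs 0 2)) (mul_mem (hle (hs 1 2)) hγm))
    (add_mem (add_mem (hle (hs 0 3)) (hle (ht 2))) (mul_mem (hle (hs 1 3)) hγm))
    (hle (hs 2 3)) (hle (ht 3))
    (by simp only [s, t]; unfold twoGenForm at h; linear_combination h)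
  obtain ⟨t0, s01, t1⟩ := eq_zero_of_quadratic_eq_zero_s9 hγ (ht 0) (hs 0 1) (ht 1) e0
  obtain ⟨s02, s12, -⟩ := eq_zero_of_quadratic_eq_zero_s9 hγ (hs 0 2) (hs 1 2) Fk.zero_mem
    (by simpa using e1)
  obtain ⟨e2, s13, -⟩ := eq_zero_of_quadratic_eq_zero_s9 hγ (add_mem (hs 0 3) (ht 2)) (hs 1 3)
    Fk.zero_mem (by simpa using e2)
  have t2 : t 2 = 0 := sub_eq_zero.mpr (h23 (sub_eq_zero.mp e4))
  have s03 : s 0 3 = 0 := by simpa [t2] using e2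
  have hdiag : ∀ i, x i * y i = z i * w i := fun i => sub_eq_zero.mp (by
    change t i = 0
    fin_cases i <;> assumption)
  have hcomm i j : s i j = s j i := by simp only [s]; ring
  refine ⟨hdiag, fun i j => sub_eq_zero.mp ?_⟩
  change s i j = 0
  by_cases hij : i = j
  · subst hij
    simp only [s]
    linear_combination 2 * hdiag i
  · fin_cases i <;> fin_cases j <;> first
      | exact absurd rfl hij
      | assumption
      | (rw [hcomm]; assumption)

/-- The coordinates of the element of the two-generator space with parameters `a` and `u`. -/
def twoGenCoord (q : ℕ) (δ₁ δ₂ τ₁ τ₂ a u : K) : Fin 4 → K :=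
  ![δ₁ * a, δ₂ * a ^ q, τ₁ * u, τ₂ * u ^ q]

theorem twoGenForm_twoGenCoord (q : ℕ) (γ ξ δ₁ δ₂ τ₁ τ₂ a u : K) :
    twoGenForm γ ξ (twoGenCoord q δ₁ δ₂ τ₁ τ₂ a u) =
      δ₁ * a + δ₂ * a ^ q * γ + τ₁ * u * ξ + τ₂ * u ^ q * ξ ^ 2 := rfl

theorem twoGenCoord_mem (q : ℕ) {δ₁ δ₂ τ₁ τ₂ a u : K} (hδ₁ : δ₁ ∈ Fk) (hδ₂ : δ₂ ∈ Fk)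
    (hτ₁ : τ₁ ∈ Fk) (hτ₂ : τ₂ ∈ Fk) (ha : a ∈ Fk) (hu : u ∈ Fk) (i : Fin 4) :
    twoGenCoord q δ₁ δ₂ τ₁ τ₂ a u i ∈ Fk := by
  fin_cases i
  exacts [mul_mem hδ₁ ha, mul_mem hδ₂ (pow_mem ha q), mul_mem hτ₁ hu, mul_mem hτ₂ (pow_mem hu q)]

theorem pow_eq_self_of_twoGenCoord_eq_smul {q : ℕ} (hq : q ≠ 0) {δ₁ δ₂ τ₁ τ₂ a u b v r : K}
    (hδ₁ : δ₁ ≠ 0) (hδ₂ : δ₂ ≠ 0) (hτ₁ : τ₁ ≠ 0) (hτ₂ : τ₂ ≠ 0)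
    (hne : twoGenCoord q δ₁ δ₂ τ₁ τ₂ b v ≠ 0)
    (h : twoGenCoord q δ₁ δ₂ τ₁ τ₂ a u = r • twoGenCoord q δ₁ δ₂ τ₁ τ₂ b v) : r ^ q = r := by
  have aux : ∀ {ε₁ ε₂ c d : K}, ε₁ ≠ 0 → ε₂ ≠ 0 → d ≠ 0 → ε₁ * c = r * (ε₁ * d) →
      ε₂ * c ^ q = r * (ε₂ * d ^ q) → r ^ q = r := by
    intro ε₁ ε₂ c d h1 h2 hd e1 e2
    have hc : c = r * d := mul_left_cancel₀ h1 (by rw [e1]; ring)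
    rw [hc, mul_pow] at e2
    exact mul_right_cancel₀ (mul_ne_zero h2 (pow_ne_zero q hd)) (by rw [← e2]; ring)
  by_cases hb : b = 0
  · have hv : v ≠ 0 := by
      rintro rfl
      refine hne (funext fun i => ?_)
      fin_cases i <;> simp [twoGenCoord, hb, hq]
    exact aux hτ₁ hτ₂ hv (congrFun h 2) (congrFun h 3)
  · exact aux hδ₁ hδ₂ hb (congrFun h 0) (congrFun h 1)

end TwoGenerators

/-- For `k ∣ m ∣ n`, `γ ∈ F_{q^m}^*` a root of an irreducible polynomial of
degree `m/k > 2` over `F_{q^k}`, `ξ ∈ F_{q^n}^*` a root of an irreducible polynomial of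
degree `n/m > 4` over `F_{q^m}`, and `δ₁, δ₂, τ₁, τ₂ ∈ F_{q^k}^*`, the set
`U = {δ₁a + δ₂aᑫγ + τ₁uξ + τ₂uᑫξ² : a, u ∈ F_{q^k}}` is a Sidon space of dimension `2k`. -/
theorem sidonSpace_two_generators_dim2k {K : Type*} [Field K] (q n k m : ℕ)
    (hq : IsPrimePow q) (hn : 0 < n) (hk : 0 < k) (hm : 0 < m)
    (hkm : k ∣ m) (hmn : m ∣ n)
    (hK : Nat.card K = q ^ n)
    (F : Subfield K) (hF : Nat.card F = q)
    (Fk : Subfield K) (hFk : Nat.card Fk = q ^ k) (hFFk : F ≤ Fk)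
    (Fm : Subfield K) (hFm : Nat.card Fm = q ^ m) (hFkFm : Fk ≤ Fm)
    (γ : K) (hγFm : γ ∈ Fm) (hγ : γ ≠ 0)
    (hdegγ : (minpoly Fk γ).natDegree = m / k) (hdegγ2 : 2 < m / k)
    (ξ : K) (hξ : ξ ≠ 0)
    (hdegξ : (minpoly Fm ξ).natDegree = n / m) (hdegξ4 : 4 < n / m)
    (δ₁ δ₂ τ₁ τ₂ : K) (hδ₁ : δ₁ ∈ Fk) (hδ₂ : δ₂ ∈ Fk) (hτ₁ : τ₁ ∈ Fk) (hτ₂ : τ₂ ∈ Fk)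
    (hδ₁0 : δ₁ ≠ 0) (hδ₂0 : δ₂ ≠ 0) (hτ₁0 : τ₁ ≠ 0) (hτ₂0 : τ₂ ≠ 0) :
    IsSidonSpace F
        (Submodule.span F
          {x : K | ∃ a ∈ Fk, ∃ u ∈ Fk,
            x = δ₁ * a + δ₂ * a ^ q * γ + τ₁ * u * ξ + τ₂ * u ^ q * ξ ^ 2}) ∧
      Module.finrank F
        ↥(Submodule.span F
          {x : K | ∃ a ∈ Fk, ∃ u ∈ Fk,
            x = δ₁ * a + δ₂ * a ^ q * γ + τ₁ * u * ξ + τ₂ * u ^ q * ξ ^ 2}) = 2 * k := by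
  have hq0 : q ≠ 0 := hq.pos.ne'
  have : Finite F := Nat.finite_of_card_ne_zero (by rw [hF]; exact hq0)
  have : Finite K := Nat.finite_of_card_ne_zero (by rw [hK]; exact pow_ne_zero n hq0)
  have := Fintype.ofFinite F
  rw [← hdegγ] at hdegγ2
  rw [← hdegξ] at hdegξ4
  let φ : K →ₐ[F] K := FiniteField.frobeniusAlgHom F K
  have hφ (x : K) : φ x = x ^ q := by
    change x ^ Fintype.card F = x ^ q
    rw [← Nat.card_eq_fintype_card, hF]
  have hφmul (c : F) (x : K) : φ (c * x) = c * φ x := map_smul φ c x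
  have hφinj : Function.Injective φ := φ.injective
  let W : Submodule F K :=
    { carrier := Fk
      add_mem' := add_mem
      zero_mem' := Fk.zero_mem
      smul_mem' := fun c x hx => mul_mem (hFFk c.2) hx }
  let Φ : W × W →ₗ[F] K :=
    { toFun := fun p => twoGenForm γ ξ (twoGenCoord q δ₁ δ₂ τ₁ τ₂ p.1 p.2)
      map_add' := fun p r => by
        simp only [twoGenForm_twoGenCoord, ← hφ, Prod.fst_add, Prod.snd_add, Submodule.coe_add,
          map_add]
        ring
      map_smul' := fun c p => by
        simp only [twoGenForm_twoGenCoord, ← hφ, Prod.smul_fst, Prod.smul_snd,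
          Submodule.coe_smul, Subfield.smul_def, smul_eq_mul, RingHom.id_apply, hφmul]
        ring }
  have hspan : span F {x : K | ∃ a ∈ Fk, ∃ u ∈ Fk,
      x = δ₁ * a + δ₂ * a ^ q * γ + τ₁ * u * ξ + τ₂ * u ^ q * ξ ^ 2} = LinearMap.range Φ := by
    rw [← span_eq (LinearMap.range Φ)]
    congr 1
    ext x
    constructor
    · rintro ⟨a, ha, u, hu, rfl⟩
      exact ⟨(⟨a, ha⟩, ⟨u, hu⟩), rfl⟩
    · rintro ⟨⟨a, u⟩, rfl⟩
      exact ⟨a, a.2, u, u.2, rfl⟩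
  rw [hspan]
  have hmem (p : W × W) (i : Fin 4) : twoGenCoord q δ₁ δ₂ τ₁ τ₂ (p.1 : K) p.2 i ∈ Fk :=
    twoGenCoord_mem q hδ₁ hδ₂ hτ₁ hτ₂ p.1.2 p.2.2 i
  have hne {p : W × W} (hp : Φ p ≠ 0) : twoGenCoord q δ₁ δ₂ τ₁ τ₂ (p.1 : K) p.2 ≠ 0 := by
    intro h0
    refine hp ?_
    change twoGenForm γ ξ (twoGenCoord q δ₁ δ₂ τ₁ τ₂ (p.1 : K) p.2) = 0
    simp [h0, twoGenForm]
  constructor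
  · refine isSidonSpace_of_mem_span_singleton ?_
    rintro _ ⟨a, rfl⟩ _ ⟨b, rfl⟩ _ ⟨c, rfl⟩ _ ⟨d, rfl⟩ ha0 hb0 hc0 hd0 hab
    obtain ⟨hdiag, hsymm⟩ := symm_mul_eq_of_twoGenForm_mul_eq hdegγ2 hdegξ4 hFkFm hγFm
      (hmem a) (hmem b) (hmem c) (hmem d) hab fun h3 => by
        change τ₂ * (a.2 : K) ^ q * (τ₂ * (b.2 : K) ^ q) =
          τ₂ * (c.2 : K) ^ q * (τ₂ * (d.2 : K) ^ q) at h3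
        change τ₁ * (a.2 : K) * (τ₁ * (b.2 : K)) = τ₁ * (c.2 : K) * (τ₁ * (d.2 : K))
        have huv : (a.2 * b.2 : K) = c.2 * d.2 := by
          refine hφinj (mul_left_cancel₀ (mul_ne_zero hτ₂0 hτ₂0) ?_)
          rw [hφ, hφ, mul_pow, mul_pow]
          linear_combination h3
        linear_combination τ₁ ^ 2 * huv
    have hF' {r : K} (h : r ^ q = r) : r ∈ F := F.mem_of_pow_natCard_eq (by rw [hF]; exact h)
    have hmul {p s : W × W} {r : K} (h : twoGenCoord q δ₁ δ₂ τ₁ τ₂ (p.1 : K) p.2 =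
        r • twoGenCoord q δ₁ δ₂ τ₁ τ₂ (s.1 : K) s.2) : Φ p = r * Φ s := by
      change twoGenForm γ ξ (twoGenCoord q δ₁ δ₂ τ₁ τ₂ (p.1 : K) p.2) =
        r * twoGenForm γ ξ (twoGenCoord q δ₁ δ₂ τ₁ τ₂ (s.1 : K) s.2)
      simp only [h, twoGenForm, Pi.smul_apply, smul_eq_mul]
      ring
    obtain ⟨r, h | h⟩ := exists_eq_smul_of_symm_mul_eq (hne ha0) (hne hc0) (hne hd0) hdiag hsymm
    · exact ⟨r, hF' (pow_eq_self_of_twoGenCoord_eq_smul hq0 hδ₁0 hδ₂0 hτ₁0 hτ₂0 (hne hc0) h),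
        .inl (hmul h)⟩
    · exact ⟨r, hF' (pow_eq_self_of_twoGenCoord_eq_smul hq0 hδ₁0 hδ₂0 hτ₁0 hτ₂0 (hne hd0) h),
        .inr (hmul h)⟩
  · have hinj : Function.Injective Φ := by
      refine (injective_iff_map_eq_zero Φ).mpr fun p hp => ?_
      have h0 := twoGenForm_eq_zero hdegγ2 hdegξ4 hFkFm hγFm (hmem p) hp
      have h1 : δ₁ * (p.1 : K) = 0 := congrFun h0 0
      have h2 : τ₁ * (p.2 : K) = 0 := congrFun h0 2
      ext
      · simpa [hδ₁0] using h1
      · simpa [hτ₁0] using h2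
    have hW : Module.finrank F W = k := by
      have hcard : Nat.card W = Nat.card F ^ Module.finrank F W := Module.natCard_eq_pow_finrank
      rw [hF, show Nat.card W = q ^ k from hFk] at hcard
      exact (Nat.pow_right_injective hq.two_le hcard).symm
    rw [LinearMap.finrank_range_of_inj hinj, Module.finrank_prod, hW, two_mul]
end
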